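/- arXiv:math/0507545 — 3 statements merged into one kernel-verified Lean document; each statement's English description precedes it below -/
import Mathlib

section
/- Let d ≥ 1 and 0 < α < d. There exists a constant c = c(α,d) > 0 such that for every t > 0 and all x, y ∈ ℝ^d, ∫_{ℝ^d} ∫_{ℝ^d} |p_t(x−w) − p_t(y−w)| · |p_t(x−z) − p_t(y−z)| · (|w−z|^{-α} + 1) dw dz ≤ c (t^{-1-α/2} + t^{-1}) |x−y|². -/
open Real MeasureTheory

/-- The `d`-dimensional heat kernel `p_t(x) = (2πt)^{-d/2} exp(-|x|²/(2t))`. -/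
noncomputable def heatKernel (d : ℕ) (t : ℝ) (x : EuclideanSpace ℝ (Fin d)) : ℝ :=
  (2 * Real.pi * t) ^ (-(d : ℝ) / 2) * Real.exp (-‖x‖ ^ 2 / (2 * t))

/-- The function `r ↦ exp (-r² / 4)` is `1`-Lipschitz. -/
lemma abs_exp_neg_sq_div_four_sub_le (a b : ℝ) :
    |Real.exp (-a ^ 2 / 4) - Real.exp (-b ^ 2 / 4)| ≤ |a - b| := by
  have hderiv : ∀ r ∈ (Set.univ : Set ℝ),
      HasDerivWithinAt (fun r : ℝ => Real.exp (-r ^ 2 / 4))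
        (Real.exp (-r ^ 2 / 4) * (-(2 * r) / 4)) Set.univ r := by
    intro r _
    have h : HasDerivAt (fun r : ℝ => -r ^ 2 / 4) (-(2 * r) / 4) r := by
      simpa using ((hasDerivAt_pow 2 r).neg.div_const 4)
    exact h.exp.hasDerivWithinAt
  have hbound : ∀ r ∈ (Set.univ : Set ℝ),
      ‖Real.exp (-r ^ 2 / 4) * (-(2 * r) / 4)‖ ≤ 1 := by
    intro r _
    have h1 : |r| / 2 ≤ Real.exp (r ^ 2 / 4) := by
      have := Real.add_one_le_exp (r ^ 2 / 4)
      nlinarith [sq_nonneg (|r| - 1), sq_abs r]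
    have h2 : Real.exp (-r ^ 2 / 4) = (Real.exp (r ^ 2 / 4))⁻¹ := by
      rw [← Real.exp_neg]
      congr 1
      ring
    have h3 : |-(2 * r) / 4| = |r| / 2 := by
      rw [show -(2 * r) / 4 = -(r / 2) by ring, abs_neg, abs_div]
      norm_num
    rw [norm_mul, Real.norm_eq_abs, Real.norm_eq_abs, h3, abs_of_pos (Real.exp_pos _), h2,
      inv_mul_le_iff₀ (Real.exp_pos _), mul_one]
    exact h1
  simpa using convex_univ.norm_image_sub_le_of_norm_hasDerivWithin_le hderiv hbound
    (Set.mem_univ b) (Set.mem_univ a)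

/-- Difference estimate for the Gaussian profile `r ↦ exp (-r² / 2)`. -/
lemma abs_exp_neg_sq_div_two_sub_le (a b : ℝ) :
    |Real.exp (-a ^ 2 / 2) - Real.exp (-b ^ 2 / 2)| ≤
      |a - b| * (Real.exp (-a ^ 2 / 4) + Real.exp (-b ^ 2 / 4)) := by
  have hsq : ∀ r : ℝ, Real.exp (-r ^ 2 / 2) = Real.exp (-r ^ 2 / 4) ^ 2 := by
    intro r
    rw [← Real.exp_nat_mul]
    congr 1
    push_cast
    ring
  rw [hsq, hsq, sq_sub_sq, abs_mul, mul_comm,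
    abs_of_pos (add_pos (Real.exp_pos (-a ^ 2 / 4)) (Real.exp_pos (-b ^ 2 / 4)))]
  exact mul_le_mul_of_nonneg_right (abs_exp_neg_sq_div_four_sub_le a b) (by positivity)

/-- Pointwise bound for differences of the heat kernel at time `s ^ 2`. -/
lemma abs_heatKernel_sub_le (d : ℕ) {s : ℝ} (hs : 0 < s) (u v : EuclideanSpace ℝ (Fin d)) :
    |heatKernel d (s ^ 2) u - heatKernel d (s ^ 2) v| ≤
      ‖u - v‖ / s * ((2 * π * s ^ 2) ^ (-(d : ℝ) / 2) *
        (Real.exp (-(4 * s ^ 2)⁻¹ * ‖u‖ ^ 2) + Real.exp (-(4 * s ^ 2)⁻¹ * ‖v‖ ^ 2))) := by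
  have h2 : ∀ r : ℝ, -r ^ 2 / (2 * s ^ 2) = -(r / s) ^ 2 / 2 := by
    intro r
    field_simp
  have h4 : ∀ r : ℝ, -(4 * s ^ 2)⁻¹ * r ^ 2 = -(r / s) ^ 2 / 4 := by
    intro r
    field_simp
  have hN : 0 < (2 * π * s ^ 2) ^ (-(d : ℝ) / 2) := by positivity
  have hdist : |‖u‖ / s - ‖v‖ / s| ≤ ‖u - v‖ / s := by
    rw [← sub_div, abs_div, abs_of_pos hs]
    gcongr
    exact abs_norm_sub_norm_le u v
  unfold heatKernel
  rw [← mul_sub, abs_mul, abs_of_pos hN, h2, h2, h4, h4, mul_left_comm]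
  gcongr
  exact (abs_exp_neg_sq_div_two_sub_le _ _).trans (by gcongr)

lemma integrable_exp_neg_mul_sq_norm (d : ℕ) {b : ℝ} (hb : 0 < b) :
    Integrable (fun v : EuclideanSpace ℝ (Fin d) => Real.exp (-b * ‖v‖ ^ 2)) := by
  apply Integrable.of_integral_ne_zero
  rw [GaussianFourier.integral_rexp_neg_mul_sq_norm hb]
  positivity

/-- The truncated Riesz kernel `1_{|u| < 1} |u|^{-α}`. -/
noncomputable def truncatedRieszKernel (d : ℕ) (α : ℝ) (u : EuclideanSpace ℝ (Fin d)) : ℝ :=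
  (Metric.ball (0 : EuclideanSpace ℝ (Fin d)) 1).indicator (fun v => ‖v‖ ^ (-α)) u

lemma truncatedRieszKernel_nonneg (d : ℕ) (α : ℝ) (u : EuclideanSpace ℝ (Fin d)) :
    0 ≤ truncatedRieszKernel d α u :=
  Set.indicator_nonneg (fun _ _ => by positivity) u

lemma integrable_truncatedRieszKernel {d : ℕ} (hd : 1 ≤ d) {α : ℝ} (hα : α < d) :
    Integrable (truncatedRieszKernel d α) := by
  refine IntegrableOn.integrable_indicator ?_ Metric.isOpen_ball.measurableSet
  refine integrableOn_ball_of_norm_le_rpow (C := 1) (α := α) (by simpa using hd) (by simpa using hα)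
    (Filter.Eventually.of_forall fun v => ?_) ?_
  · rw [one_mul, Real.norm_of_nonneg (by positivity)]
  · exact (measurable_norm.pow_const _).aestronglyMeasurable

/-- The Riesz kernel at scale `s` is dominated by its rescaled truncation plus a constant. -/
lemma norm_rpow_neg_le {d : ℕ} {α s : ℝ} (hα : 0 < α) (hs : 0 < s)
    (v : EuclideanSpace ℝ (Fin d)) :
    ‖v‖ ^ (-α) ≤ s ^ (-α) * (truncatedRieszKernel d α (s⁻¹ • v) + 1) := by
  have hscale : ‖v‖ ^ (-α) = s ^ (-α) * ‖s⁻¹ • v‖ ^ (-α) := by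
    rw [← Real.mul_rpow hs.le (norm_nonneg _), norm_smul, norm_inv, Real.norm_of_nonneg hs.le,
      mul_inv_cancel_left₀ hs.ne']
  rw [hscale]
  gcongr
  by_cases hv : s⁻¹ • v ∈ Metric.ball (0 : EuclideanSpace ℝ (Fin d)) 1
  · rw [truncatedRieszKernel, Set.indicator_of_mem hv]
    linarith
  · have h1 : 1 ≤ ‖s⁻¹ • v‖ := by simpa using hv
    have h2 := Real.rpow_le_one_of_one_le_of_nonpos h1 (neg_nonpos.2 hα.le)
    linarith [truncatedRieszKernel_nonneg d α (s⁻¹ • v)]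

lemma integral_exp_neg_sq_norm_normalized (d : ℕ) {s : ℝ} (hs : 0 < s) :
    (2 * π * s ^ 2) ^ (-(d : ℝ) / 2) *
      ∫ v : EuclideanSpace ℝ (Fin d), Real.exp (-(4 * s ^ 2)⁻¹ * ‖v‖ ^ 2) =
      2 ^ ((d : ℝ) / 2) := by
  rw [GaussianFourier.integral_rexp_neg_mul_sq_norm (by positivity), finrank_euclideanSpace_fin,
    show π / (4 * s ^ 2)⁻¹ = 2 * (2 * π * s ^ 2) by rw [div_inv_eq_mul]; ring,
    Real.mul_rpow zero_le_two (by positivity), mul_left_comm, ← Real.rpow_add (by positivity)]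
  simp [neg_div]

lemma two_pi_mul_sq_rpow_mul_pow (d : ℕ) {s : ℝ} (hs : 0 < s) :
    (2 * π * s ^ 2) ^ (-(d : ℝ) / 2) * s ^ d = (2 * π) ^ (-(d : ℝ) / 2) := by
  rw [Real.mul_rpow (by positivity) (by positivity), mul_assoc, ← Real.rpow_natCast s 2,
    ← Real.rpow_mul hs.le, ← Real.rpow_natCast s d, ← Real.rpow_add hs,
    show ((2 : ℕ) : ℝ) * (-(d : ℝ) / 2) + d = 0 by push_cast; ring, Real.rpow_zero, mul_one]

/-- For `0 < α < d` there is `c = c(α,d) > 0` such that for every `t > 0`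
and `x, y ∈ ℝ^d`,
`∫∫ |p_t(x−w) − p_t(y−w)| |p_t(x−z) − p_t(y−z)| (|w−z|^{-α}+1) dw dz
  ≤ c (t^{-1-α/2} + t^{-1}) |x−y|²`. -/
theorem heatKernel_space_difference_correlation_bound
    (d : ℕ) (hd : 1 ≤ d) (α : ℝ) (hα0 : 0 < α) (hαd : α < d) :
    ∃ c : ℝ, 0 < c ∧ ∀ (t : ℝ), 0 < t → ∀ (x y : EuclideanSpace ℝ (Fin d)),
      (∫ w : EuclideanSpace ℝ (Fin d), ∫ z : EuclideanSpace ℝ (Fin d),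
          |heatKernel d t (x - w) - heatKernel d t (y - w)| *
            |heatKernel d t (x - z) - heatKernel d t (y - z)| * (‖w - z‖ ^ (-α) + 1))
        ≤ c * (t ^ (-1 - α / 2) + t ^ (-1 : ℝ)) * ‖x - y‖ ^ 2 := by
  set K : ℝ := ∫ u, truncatedRieszKernel d α u with hK
  have hK0 : 0 ≤ K := integral_nonneg (truncatedRieszKernel_nonneg d α)
  set P : ℝ := 2 ^ ((d : ℝ) / 2) with hP
  have hP0 : 0 < P := by positivity
  set Q : ℝ := (2 * π) ^ (-(d : ℝ) / 2) with hQ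
  have hQ0 : 0 < Q := by positivity
  refine ⟨(2 * Q * K + 2 * P) * (2 * P), by positivity, ?_⟩
  intro t ht x y
  obtain ⟨s, hs, rfl⟩ : ∃ s : ℝ, 0 < s ∧ t = s ^ 2 :=
    ⟨√t, Real.sqrt_pos.2 ht, (Real.sq_sqrt ht.le).symm⟩
  set N : ℝ := (2 * π * s ^ 2) ^ (-(d : ℝ) / 2) with hN
  have hN0 : 0 < N := by positivity
  set A : ℝ := ‖x - y‖ / s with hA
  have hA0 : 0 ≤ A := by positivity
  set σ : ℝ := s ^ (-α) with hσ
  have hσ0 : 0 < σ := by positivity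
  set g : EuclideanSpace ℝ (Fin d) → ℝ := fun v => Real.exp (-(4 * s ^ 2)⁻¹ * ‖v‖ ^ 2) with hg
  have hg0 : ∀ v, 0 < g v := fun v => Real.exp_pos _
  have hg1 : ∀ v, g v ≤ 1 := fun v => Real.exp_le_one_iff.2 (by
    rw [neg_mul]
    exact neg_nonpos.2 (by positivity))
  have hgi : Integrable g := integrable_exp_neg_mul_sq_norm d (by positivity)
  set Φ : EuclideanSpace ℝ (Fin d) → ℝ := fun z => N * (g (x - z) + g (y - z)) with hΦ
  have hΦ0 : ∀ z, 0 ≤ Φ z := fun z => by have := hg0 (x - z); have := hg0 (y - z); positivity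
  have hΦi : Integrable Φ := ((hgi.comp_sub_left x).add (hgi.comp_sub_left y)).const_mul N
  have hΦint : ∫ z, Φ z = 2 * P := by
    simp only [hΦ]
    rw [integral_const_mul, integral_add (hgi.comp_sub_left x) (hgi.comp_sub_left y),
      integral_sub_left_eq_self g volume x, integral_sub_left_eq_self g volume y, ← two_mul,
      mul_left_comm, integral_exp_neg_sq_norm_normalized d hs]
  have hD : ∀ z, |heatKernel d (s ^ 2) (x - z) - heatKernel d (s ^ 2) (y - z)| ≤ A * Φ z := by
    intro z
    have h := abs_heatKernel_sub_le d hs (x - z) (y - z)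
    rwa [sub_sub_sub_cancel_right] at h
  set H : EuclideanSpace ℝ (Fin d) → ℝ := fun v => truncatedRieszKernel d α (s⁻¹ • v) with hH
  have hH0 : ∀ v, 0 ≤ H v := fun v => truncatedRieszKernel_nonneg d α _
  have hHi : Integrable H := (integrable_truncatedRieszKernel hd hαd).comp_smul (by positivity)
  have hHint : ∫ v, H v = s ^ d * K := by
    simp only [hH]
    rw [Measure.integral_comp_inv_smul_of_nonneg volume (truncatedRieszKernel d α) hs.le,
      finrank_euclideanSpace_fin, smul_eq_mul]
  have hinner : ∀ w, ∫ z, |heatKernel d (s ^ 2) (x - w) - heatKernel d (s ^ 2) (y - w)| *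
      |heatKernel d (s ^ 2) (x - z) - heatKernel d (s ^ 2) (y - z)| * (‖w - z‖ ^ (-α) + 1) ≤
      A * Φ w * (A * (σ * (2 * Q * K) + (σ + 1) * (2 * P))) := by
    intro w
    have hpt : ∀ z, |heatKernel d (s ^ 2) (x - w) - heatKernel d (s ^ 2) (y - w)| *
        |heatKernel d (s ^ 2) (x - z) - heatKernel d (s ^ 2) (y - z)| * (‖w - z‖ ^ (-α) + 1) ≤
        A * Φ w * (A * (σ * (2 * N) * H (w - z) + (σ + 1) * Φ z)) := by
      intro z
      have h1 : ‖w - z‖ ^ (-α) ≤ σ * (H (w - z) + 1) := norm_rpow_neg_le hα0 hs (w - z)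
      have h2 : Φ z ≤ 2 * N := by
        simp only [hΦ]
        nlinarith [hg1 (x - z), hg1 (y - z)]
      have h3 : Φ z * (‖w - z‖ ^ (-α) + 1) ≤ σ * (2 * N) * H (w - z) + (σ + 1) * Φ z := by
        calc Φ z * (‖w - z‖ ^ (-α) + 1) ≤ Φ z * (σ * (H (w - z) + 1) + 1) := by
              gcongr
          _ = σ * Φ z * H (w - z) + (σ + 1) * Φ z := by ring
          _ ≤ _ := by
              gcongr
              exact hH0 _
      have h4 := hΦ0 w
      calc _ ≤ A * Φ w * (A * Φ z) * (‖w - z‖ ^ (-α) + 1) := by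
            gcongr
            · exact hD w
            · exact hD z
        _ = A * Φ w * (A * (Φ z * (‖w - z‖ ^ (-α) + 1))) := by ring
        _ ≤ _ := by gcongr
    have hHw : Integrable (fun z => σ * (2 * N) * H (w - z)) := (hHi.comp_sub_left w).const_mul _
    have hΦw : Integrable (fun z => (σ + 1) * Φ z) := hΦi.const_mul _
    refine (integral_mono_of_nonneg (Filter.Eventually.of_forall fun z => by positivity)
      (((hHw.add hΦw).const_mul A).const_mul (A * Φ w))
      (Filter.Eventually.of_forall hpt)).trans_eq ?_
    simp only [Pi.add_apply]
    rw [integral_const_mul, integral_const_mul, integral_add hHw hΦw, integral_const_mul,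
      integral_const_mul, integral_sub_left_eq_self H volume w, hHint, hΦint]
    congr 2
    rw [hQ, ← two_pi_mul_sq_rpow_mul_pow d hs]
    ring
  have hinner0 : ∀ w, 0 ≤ ∫ z, |heatKernel d (s ^ 2) (x - w) - heatKernel d (s ^ 2) (y - w)| *
      |heatKernel d (s ^ 2) (x - z) - heatKernel d (s ^ 2) (y - z)| * (‖w - z‖ ^ (-α) + 1) :=
    fun w => integral_nonneg fun z => by positivity
  refine (integral_mono_of_nonneg (Filter.Eventually.of_forall hinner0)
    ((hΦi.const_mul A).mul_const _) (Filter.Eventually.of_forall hinner)).trans ?_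
  rw [integral_mul_const, integral_const_mul, hΦint]
  have ht1 : (s ^ 2) ^ (-1 : ℝ) = (s ^ 2)⁻¹ := Real.rpow_neg_one _
  have ht2 : (s ^ 2) ^ (-1 - α / 2) = (s ^ 2)⁻¹ * σ := by
    rw [sub_eq_add_neg, Real.rpow_add ht, ht1, ← Real.rpow_natCast s 2, ← Real.rpow_mul hs.le, hσ]
    congr 2
    push_cast
    ring
  have hA2 : A ^ 2 = (s ^ 2)⁻¹ * ‖x - y‖ ^ 2 := by
    rw [hA, div_pow, div_eq_inv_mul]
  rw [ht1, ht2]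
  calc A * (2 * P) * (A * (σ * (2 * Q * K) + (σ + 1) * (2 * P)))
      ≤ A * (2 * P) * (A * ((σ + 1) * (2 * Q * K) + (σ + 1) * (2 * P))) := by
        gcongr
        linarith
    _ = (2 * Q * K + 2 * P) * (2 * P) * (σ + 1) * A ^ 2 := by ring
    _ = _ := by
        rw [hA2]
        ring
end

section
/- Let d ≥ 1 and 0 < α < d. There exists a constant c = c(α,d) > 0 such that for all 0 < t ≤ t' and every x ∈ ℝ^d, ∫_{ℝ^d} ∫_{ℝ^d} |p_t(x−w) − p_{t'}(x−w)| · |p_t(x−z) − p_{t'}(x−z)| · (|w−z|^{-α} + 1) dw dz ≤ c (t^{-2-α/2} + t^{-2}) (t'−t)². -/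
open Real MeasureTheory

lemma integral_heatKernel (d : ℕ) {t : ℝ} (ht : 0 < t) :
    ∫ x : EuclideanSpace ℝ (Fin d), heatKernel d t x = 1 := by
  have hb : 0 < 1 / (2 * t) := by positivity
  have h := GaussianFourier.integral_rexp_neg_mul_sq_norm
    (V := EuclideanSpace ℝ (Fin d)) hb
  have h2 : ∀ v : EuclideanSpace ℝ (Fin d),
      rexp (-‖v‖ ^ 2 / (2 * t)) = rexp (-(1 / (2 * t)) * ‖v‖ ^ 2) := fun v => by
    congr 1; ring
  have h3 : π / (1 / (2 * t)) = 2 * π * t := by field_simp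
  simp only [heatKernel, h2]
  rw [integral_const_mul, h, finrank_euclideanSpace_fin, h3,
    ← Real.rpow_add (by positivity), show -(d : ℝ) / 2 + d / 2 = 0 by ring, Real.rpow_zero]

lemma integrable_heatKernel (d : ℕ) {t : ℝ} (ht : 0 < t) : Integrable (heatKernel d t) :=
  Integrable.of_integral_ne_zero (by rw [integral_heatKernel d ht]; exact one_ne_zero)

/-- Bernoulli's inequality for nonpositive exponents. -/
lemma one_sub_mul_le_rpow_neg {s a : ℝ} (hs : 0 < s) (ha : 0 ≤ a) :
    1 - s ^ (-a) ≤ a * (s - 1) := by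
  rw [Real.rpow_def_of_pos hs]
  nlinarith [Real.add_one_le_exp (Real.log s * (-a)), Real.log_le_sub_one_of_pos hs]

lemma heatKernel_eq_rpow_mul (d : ℕ) {t t' : ℝ} (ht : 0 < t) (htt' : t ≤ t')
    (x : EuclideanSpace ℝ (Fin d)) :
    heatKernel d t' x =
      (t' / t) ^ (-((d : ℝ) / 2)) * ((2 * π * t) ^ (-(d : ℝ) / 2) * rexp (-‖x‖ ^ 2 / (2 * t'))) := by
  have h : 2 * π * t' = (t' / t) * (2 * π * t) := by field_simp
  have ht' : 0 < t' := ht.trans_le htt'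
  rw [heatKernel, h, Real.mul_rpow (by positivity) (by positivity), neg_div, mul_assoc]

/-- Splitting the time increment into the change of the exponential and of the prefactor. -/
lemma abs_heatKernel_sub_le_s11 (d : ℕ) {t t' : ℝ} (ht : 0 < t) (htt' : t ≤ t')
    (x : EuclideanSpace ℝ (Fin d)) :
    |heatKernel d t x - heatKernel d t' x| ≤
      (heatKernel d t' x - (t' / t) ^ (-((d : ℝ) / 2)) * heatKernel d t x) +
        (1 - (t' / t) ^ (-((d : ℝ) / 2))) * heatKernel d t x := by
  have hA : 0 < (2 * π * t) ^ (-(d : ℝ) / 2) := by positivity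
  have hs : 0 ≤ (t' / t) ^ (-((d : ℝ) / 2)) := by
    have := ht.trans_le htt'; positivity
  have hs1 : (t' / t) ^ (-((d : ℝ) / 2)) ≤ 1 :=
    Real.rpow_le_one_of_one_le_of_nonpos ((one_le_div ht).2 htt')
      (neg_nonpos.2 (by positivity))
  have hp : 0 ≤ heatKernel d t x := by unfold heatKernel; positivity
  have he : rexp (-‖x‖ ^ 2 / (2 * t)) ≤ rexp (-‖x‖ ^ 2 / (2 * t')) := by
    apply Real.exp_le_exp.2
    rw [neg_div, neg_div]
    gcongr
  have h1 : (t' / t) ^ (-((d : ℝ) / 2)) * heatKernel d t x ≤ heatKernel d t' x := by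
    rw [heatKernel_eq_rpow_mul d ht htt', heatKernel]
    gcongr
  rw [abs_le]
  constructor <;> nlinarith [mul_nonneg (sub_nonneg.2 hs1) hp]

lemma integral_abs_heatKernel_sub_le (d : ℕ) {t t' : ℝ} (ht : 0 < t) (htt' : t ≤ t') :
    ∫ x : EuclideanSpace ℝ (Fin d), |heatKernel d t x - heatKernel d t' x| ≤
      d * ((t' - t) / t) := by
  have ht' : 0 < t' := ht.trans_le htt'
  have i := integrable_heatKernel d ht
  have i' := integrable_heatKernel d ht'
  set r := (t' / t) ^ (-((d : ℝ) / 2))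
  have j : Integrable fun x => heatKernel d t' x - r * heatKernel d t x := i'.sub (i.const_mul r)
  have h := integral_mono (i.sub i').abs (j.add (i.const_mul (1 - r)))
    (abs_heatKernel_sub_le_s11 d ht htt')
  simp only [Pi.add_apply, Pi.sub_apply] at h
  rw [integral_add j (i.const_mul _), integral_sub i' (i.const_mul _),
    integral_const_mul, integral_const_mul, integral_heatKernel d ht,
    integral_heatKernel d ht'] at h
  have hB := one_sub_mul_le_rpow_neg (div_pos ht' ht) (a := (d : ℝ) / 2) (by positivity)
  have hd : (t' - t) / t = t' / t - 1 := by field_simp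
  rw [hd]
  linarith

lemma exp_neg_div_sub_exp_neg_le {u s : ℝ} (hs : 1 ≤ s) :
    rexp (-(u / s)) - rexp (-u) ≤ s - 1 := by
  have h0 : 0 < s := by linarith
  have hu : -u = -(u / s) + -(u / s * (s - 1)) := by field_simp; ring
  have h1 := Real.add_one_le_exp (-(u / s * (s - 1)))
  have h2 : u / s * rexp (-(u / s)) ≤ 1 := by
    have h := Real.add_one_le_exp (u / s)
    rw [Real.exp_neg, ← div_eq_mul_inv, div_le_one (Real.exp_pos _)]
    linarith
  rw [hu, Real.exp_add]
  nlinarith [Real.exp_pos (-(u / s)), mul_le_mul_of_nonneg_left h1 (Real.exp_pos (-(u / s))).le]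

lemma abs_heatKernel_sub_le_const (d : ℕ) {t t' : ℝ} (ht : 0 < t) (htt' : t ≤ t')
    (x : EuclideanSpace ℝ (Fin d)) :
    |heatKernel d t x - heatKernel d t' x| ≤
      (2 * π * t) ^ (-(d : ℝ) / 2) * ((1 + d / 2) * ((t' - t) / t)) := by
  have ht' : 0 < t' := ht.trans_le htt'
  have hA : 0 < (2 * π * t) ^ (-(d : ℝ) / 2) := by positivity
  have hst : 1 ≤ t' / t := (one_le_div ht).2 htt'
  have hs : 0 ≤ (t' / t) ^ (-((d : ℝ) / 2)) := by positivity
  have hs1 : (t' / t) ^ (-((d : ℝ) / 2)) ≤ 1 :=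
    Real.rpow_le_one_of_one_le_of_nonpos hst (neg_nonpos.2 (by positivity))
  have hB := one_sub_mul_le_rpow_neg (div_pos ht' ht) (a := (d : ℝ) / 2) (by positivity)
  have hd : (t' - t) / t = t' / t - 1 := by field_simp
  have hE := exp_neg_div_sub_exp_neg_le (u := ‖x‖ ^ 2 / (2 * t)) hst
  rw [show -(‖x‖ ^ 2 / (2 * t) / (t' / t)) = -‖x‖ ^ 2 / (2 * t') by field_simp, ← neg_div] at hE
  have hE1 : rexp (-‖x‖ ^ 2 / (2 * t)) ≤ 1 := by
    rw [Real.exp_le_one_iff, neg_div, neg_nonpos]; positivity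
  refine (abs_heatKernel_sub_le_s11 d ht htt' x).trans ?_
  rw [heatKernel_eq_rpow_mul d ht htt', heatKernel, hd]
  set s := t' / t
  set r := s ^ (-((d : ℝ) / 2))
  have h1 : r * (rexp (-‖x‖ ^ 2 / (2 * t')) - rexp (-‖x‖ ^ 2 / (2 * t))) ≤ s - 1 :=
    (mul_le_mul_of_nonneg_left hE hs).trans
      (mul_le_of_le_one_left (by linarith) hs1)
  have h2 : (1 - r) * rexp (-‖x‖ ^ 2 / (2 * t)) ≤ d / 2 * (s - 1) :=
    (mul_le_of_le_one_right (by linarith) hE1).trans hB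
  calc _ = (2 * π * t) ^ (-(d : ℝ) / 2) *
        (r * (rexp (-‖x‖ ^ 2 / (2 * t')) - rexp (-‖x‖ ^ 2 / (2 * t))) +
          (1 - r) * rexp (-‖x‖ ^ 2 / (2 * t))) := by ring
    _ ≤ _ := by gcongr; linarith

/-- The Riesz kernel `|x|^{-α}` truncated to the unit ball. -/
noncomputable def truncatedRiesz (d : ℕ) (α : ℝ) : EuclideanSpace ℝ (Fin d) → ℝ :=
  (Metric.ball 0 1).indicator fun x => ‖x‖ ^ (-α)

lemma truncatedRiesz_nonneg (d : ℕ) (α : ℝ) (x : EuclideanSpace ℝ (Fin d)) :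
    0 ≤ truncatedRiesz d α x :=
  Set.indicator_nonneg (fun _ _ => by positivity) x

lemma integrable_truncatedRiesz {d : ℕ} (hd : 1 ≤ d) {α : ℝ} (hαd : α < d) :
    Integrable (truncatedRiesz d α) := by
  refine IntegrableOn.integrable_indicator ?_ measurableSet_ball
  refine integrableOn_ball_of_norm_le_rpow (C := 1) (α := α) (by simpa using hd)
    (by simpa using hαd) ?_ ?_
  · refine Filter.Eventually.of_forall fun x => ?_
    rw [Real.norm_of_nonneg (by positivity)]; simp
  · exact (by fun_prop :
      Measurable fun x : EuclideanSpace ℝ (Fin d) => ‖x‖ ^ (-α)).aestronglyMeasurable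

/-- Outside the ball of radius `R` the Riesz kernel is at most `R ^ (-α)`. -/
lemma norm_rpow_neg_le_truncatedRiesz {d : ℕ} {α R : ℝ} (hα : 0 ≤ α) (hR : 0 < R)
    (x : EuclideanSpace ℝ (Fin d)) :
    ‖x‖ ^ (-α) ≤ R ^ (-α) + R ^ (-α) * truncatedRiesz d α (R⁻¹ • x) := by
  have hR' : 0 < R ^ (-α) := by positivity
  by_cases hx : ‖x‖ < R
  · have hmem : R⁻¹ • x ∈ Metric.ball (0 : EuclideanSpace ℝ (Fin d)) 1 := by
      rw [mem_ball_zero_iff, norm_smul, norm_inv, Real.norm_of_nonneg hR.le, inv_mul_lt_iff₀ hR]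
      simpa using hx
    rw [truncatedRiesz, Set.indicator_of_mem hmem, norm_smul, norm_inv,
      Real.norm_of_nonneg hR.le, ← Real.mul_rpow hR.le (by positivity),
      mul_inv_cancel_left₀ hR.ne']
    linarith
  · have h1 : ‖x‖ ^ (-α) ≤ R ^ (-α) :=
      Real.rpow_le_rpow_of_nonpos hR (not_lt.1 hx) (neg_nonpos.2 hα)
    have := mul_nonneg hR'.le (truncatedRiesz_nonneg d α (R⁻¹ • x))
    linarith

/-- A bounded integrable function integrates against a shifted Riesz kernel, uniformly in the
shift. -/
lemma integral_mul_norm_rpow_neg_add_one_le {d : ℕ} (hd : 1 ≤ d) {α : ℝ} (hα : 0 ≤ α)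
    (hαd : α < d) {f : EuclideanSpace ℝ (Fin d) → ℝ} (hf : Integrable f) (hf0 : ∀ z, 0 ≤ f z)
    {M R : ℝ} (hM : ∀ z, f z ≤ M) (hR : 0 < R) (w : EuclideanSpace ℝ (Fin d)) :
    ∫ z, f z * (‖w - z‖ ^ (-α) + 1) ≤
      (R ^ (-α) + 1) * (∫ z, f z) +
        M * R ^ (-α) * (R ^ d * ∫ z, truncatedRiesz d α z) := by
  have hg : Integrable fun z => truncatedRiesz d α (R⁻¹ • (w - z)) :=
    ((integrable_truncatedRiesz hd hαd).comp_smul (inv_ne_zero hR.ne')).comp_sub_left w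
  have hgi : ∫ z, truncatedRiesz d α (R⁻¹ • (w - z)) = R ^ d * ∫ z, truncatedRiesz d α z := by
    rw [integral_sub_left_eq_self (fun z => truncatedRiesz d α (R⁻¹ • z)) volume w,
      Measure.integral_comp_inv_smul_of_nonneg _ _ hR.le, finrank_euclideanSpace_fin, smul_eq_mul]
  have hR' : 0 < R ^ (-α) := by positivity
  calc _ ≤ ∫ z, ((R ^ (-α) + 1) * f z +
        M * R ^ (-α) * truncatedRiesz d α (R⁻¹ • (w - z))) := by
        refine integral_mono_of_nonneg
          (Filter.Eventually.of_forall fun z => mul_nonneg (hf0 z) (by positivity))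
          ((hf.const_mul _).add (hg.const_mul _)) (Filter.Eventually.of_forall fun z => ?_)
        have h1 := mul_le_mul_of_nonneg_left
          (norm_rpow_neg_le_truncatedRiesz hα hR (w - z)) (hf0 z)
        have h2 := mul_le_mul_of_nonneg_right (hM z)
          (mul_nonneg hR'.le (truncatedRiesz_nonneg d α (R⁻¹ • (w - z))))
        simp only
        linarith
    _ = _ := by
        rw [integral_add (hf.const_mul _) (hg.const_mul _), integral_const_mul,
          integral_const_mul, hgi]

/-- For `0 < α < d` there is `c = c(α,d) > 0` such that for all
`0 < t ≤ t'` and `x ∈ ℝ^d`,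
`∫∫ |p_t(x−w) − p_{t'}(x−w)| |p_t(x−z) − p_{t'}(x−z)| (|w−z|^{-α}+1) dw dz
  ≤ c (t^{-2-α/2} + t^{-2}) (t'−t)²`. -/
theorem heatKernel_time_difference_correlation_bound
    (d : ℕ) (hd : 1 ≤ d) (α : ℝ) (hα0 : 0 < α) (hαd : α < d) :
    ∃ c : ℝ, 0 < c ∧ ∀ (t t' : ℝ), 0 < t → t ≤ t' → ∀ x : EuclideanSpace ℝ (Fin d),
      (∫ w : EuclideanSpace ℝ (Fin d), ∫ z : EuclideanSpace ℝ (Fin d),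
          |heatKernel d t (x - w) - heatKernel d t' (x - w)| *
            |heatKernel d t (x - z) - heatKernel d t' (x - z)| * (‖w - z‖ ^ (-α) + 1))
        ≤ c * (t ^ (-2 - α / 2) + t ^ (-2 : ℝ)) * (t' - t) ^ 2 := by
  set K := ∫ z, truncatedRiesz d α z with hK
  have hK0 : 0 ≤ K := integral_nonneg (truncatedRiesz_nonneg d α)
  have hd0 : (0 : ℝ) < d := by exact_mod_cast hd
  set K' := (2 * π) ^ (-(d : ℝ) / 2) * (1 + d / 2) * K with hK'
  have hK'0 : 0 ≤ K' := by positivity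
  refine ⟨d * (d + K'), by positivity, fun t t' ht htt' x => ?_⟩
  set f : EuclideanSpace ℝ (Fin d) → ℝ :=
    fun z => |heatKernel d t (x - z) - heatKernel d t' (x - z)| with hf
  set δ := (t' - t) / t with hδ
  have hδ0 : 0 ≤ δ := div_nonneg (sub_nonneg.2 htt') ht.le
  have hf0 : ∀ z, 0 ≤ f z := fun z => abs_nonneg _
  have hfi : Integrable f :=
    ((integrable_heatKernel d ht).sub
      (integrable_heatKernel d (ht.trans_le htt'))).abs.comp_sub_left x
  have hfL : ∫ z, f z ≤ d * δ := by
    rw [hf, integral_sub_left_eq_self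
      (fun z => |heatKernel d t z - heatKernel d t' z|) volume x]
    exact integral_abs_heatKernel_sub_le d ht htt'
  have hRα : √t ^ (-α) = t ^ (-α / 2) := by
    rw [Real.sqrt_eq_rpow, ← Real.rpow_mul ht.le]; congr 1; ring
  have hRd : (2 * π * t) ^ (-(d : ℝ) / 2) * √t ^ d = (2 * π) ^ (-(d : ℝ) / 2) := by
    rw [← Real.rpow_natCast, Real.sqrt_eq_rpow, ← Real.rpow_mul ht.le,
      Real.mul_rpow (by positivity) ht.le, mul_assoc, ← Real.rpow_add ht,
      show -(d : ℝ) / 2 + 1 / 2 * d = 0 by ring, Real.rpow_zero, mul_one]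
  have hτ : 0 < t ^ (-α / 2) := by positivity
  set B := (d + K') * (t ^ (-α / 2) + 1) * δ with hB
  have hinner : ∀ w, ∫ z, f z * (‖w - z‖ ^ (-α) + 1) ≤ B := fun w => by
    have h := integral_mul_norm_rpow_neg_add_one_le hd hα0.le hαd hfi hf0
      (fun z => abs_heatKernel_sub_le_const d ht htt' (x - z)) (Real.sqrt_pos.2 ht) w
    rw [hRα] at h
    refine h.trans ?_
    calc _ ≤ (t ^ (-α / 2) + 1) * (d * δ) + ((2 * π * t) ^ (-(d : ℝ) / 2) * √t ^ d) *
          ((1 + d / 2) * K) * δ * t ^ (-α / 2) := by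
          rw [← hK, ← hδ]
          have := mul_le_mul_of_nonneg_left hfL (by positivity : 0 ≤ t ^ (-α / 2) + 1)
          linarith
      _ = (t ^ (-α / 2) + 1) * (d * δ) + K' * δ * t ^ (-α / 2) := by rw [hRd, hK']; ring
      _ ≤ B := by
          have := mul_nonneg hK'0 hδ0
          rw [hB]; linarith
  calc _ = ∫ w, f w * ∫ z, f z * (‖w - z‖ ^ (-α) + 1) := by
        simp_rw [← integral_const_mul, hf, mul_assoc]
    _ ≤ ∫ w, f w * B := by
        refine integral_mono_of_nonneg (Filter.Eventually.of_forall fun w =>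
          mul_nonneg (hf0 w) (integral_nonneg fun z => mul_nonneg (hf0 z) (by positivity)))
          (hfi.mul_const _) (Filter.Eventually.of_forall fun w =>
            mul_le_mul_of_nonneg_left (hinner w) (hf0 w))
    _ = (∫ w, f w) * B := integral_mul_const _ _
    _ ≤ d * δ * B := by gcongr
    _ = _ := by
        have h1 : t ^ (-2 - α / 2) = t ^ (-2 : ℝ) * t ^ (-α / 2) := by
          rw [← Real.rpow_add ht]; congr 1; ring
        have h2 : t ^ (-2 : ℝ) = (t ^ 2)⁻¹ := by
          rw [Real.rpow_neg ht.le]; norm_cast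
        rw [h1, h2, hB, hδ]
        field_simp
end

section
/- Let d ≥ 1 and 0 < α < min(d, 2). Let b, c ≥ 0 satisfy c < (b + 1 − α/2)/2 and let a ∈ (c, 1 − α/2). Then there is a finite constant C = C(a,b,c,α,d) such that for every t ≥ 0, Q(t) := ∫_0^t ∫_0^t (t−r)^{a−1−c} (t−r')^{a−1−c} ∫_0^{min(r,r')} (t−s)^b (r−s)^{-a} (r'−s)^{-a} [ ∫_{ℝ^d} ∫_{ℝ^d} p_{r−s}(w) p_{r'−s}(z) (|w−z|^{-α} + 1) dw dz ] ds dr dr' ≤ C ( t^{b+1−α/2−2c} + t^{b+1−2c} ). -/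
open Real MeasureTheory

theorem heatKernel_nonneg (d : ℕ) {v : ℝ} (hv : 0 < v) (x : EuclideanSpace ℝ (Fin d)) :
    0 ≤ heatKernel d v x := by
  unfold heatKernel
  positivity

theorem heatKernel_le (d : ℕ) {v : ℝ} (hv : 0 < v) (x : EuclideanSpace ℝ (Fin d)) :
    heatKernel d v x ≤ (2 * Real.pi * v) ^ (-(d : ℝ) / 2) := by
  unfold heatKernel
  refine mul_le_of_le_one_right (by positivity) (Real.exp_le_one_iff.2 ?_)
  exact div_nonpos_of_nonpos_of_nonneg (by simp) (by positivity)

theorem integral_heatKernel_s14 (d : ℕ) {v : ℝ} (hv : 0 < v) :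
    ∫ x, heatKernel d v x = 1 := by
  have hexp : ∀ x : EuclideanSpace ℝ (Fin d),
      heatKernel d v x =
        (2 * Real.pi * v) ^ (-(d : ℝ) / 2) * Real.exp (-(1 / (2 * v)) * ‖x‖ ^ 2) := by
    intro x
    unfold heatKernel
    congr 2
    ring
  have hpos : 0 < 2 * Real.pi * v := by positivity
  simp_rw [hexp]
  rw [integral_const_mul, GaussianFourier.integral_rexp_neg_mul_sq_norm (by positivity),
    finrank_euclideanSpace_fin,
    show Real.pi / (1 / (2 * v)) = 2 * Real.pi * v by field_simp, ← Real.rpow_add hpos,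
    show -(d : ℝ) / 2 + (d : ℝ) / 2 = 0 by ring, Real.rpow_zero]

theorem integrable_heatKernel_s14 (d : ℕ) {v : ℝ} (hv : 0 < v) :
    Integrable (heatKernel d v) := by
  apply Integrable.of_integral_ne_zero
  rw [integral_heatKernel_s14 d hv]
  exact one_ne_zero

theorem integrableOn_ball_norm_rpow_neg {d : ℕ} (hd : 1 ≤ d) {α : ℝ} (hα : α < d) (R : ℝ) :
    IntegrableOn (fun y : EuclideanSpace ℝ (Fin d) => ‖y‖ ^ (-α)) (Metric.ball 0 R) := by
  have : Nonempty (Fin d) := ⟨⟨0, hd⟩⟩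
  rw [integrableOn_fun_norm_addHaar volume (f := fun y : ℝ => y ^ (-α)),
    finrank_euclideanSpace_fin]
  have h : IntegrableOn (fun y : ℝ => y ^ ((d : ℝ) - 1 - α)) (Set.Ioo 0 R) := by
    rcases le_or_gt R 0 with hR | hR
    · simp [Set.Ioo_eq_empty_of_le hR]
    · exact (intervalIntegral.integrableOn_Ioo_rpow_iff hR).2 (by linarith)
  refine h.congr_fun (fun y hy => ?_) measurableSet_Ioo
  simp only [smul_eq_mul]
  rw [← Real.rpow_natCast, ← Real.rpow_add hy.1, Nat.cast_sub hd]
  simp [sub_eq_add_neg]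

theorem setIntegral_ball_norm_rpow_neg (d : ℕ) (α : ℝ) {R : ℝ} (hR : 0 < R) :
    ∫ y in Metric.ball (0 : EuclideanSpace ℝ (Fin d)) R, ‖y‖ ^ (-α) =
      R ^ ((d : ℝ) - α) *
        ∫ y in Metric.ball (0 : EuclideanSpace ℝ (Fin d)) 1, ‖y‖ ^ (-α) := by
  have h := Measure.setIntegral_comp_smul_of_pos volume
    (fun y : EuclideanSpace ℝ (Fin d) => ‖y‖ ^ (-α)) (Metric.ball 0 1) hR
  rw [smul_unitBall_of_pos hR, finrank_euclideanSpace_fin, smul_eq_mul] at h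
  have h2 : ∀ y : EuclideanSpace ℝ (Fin d), ‖R • y‖ ^ (-α) = R ^ (-α) * ‖y‖ ^ (-α) := by
    intro y
    rw [norm_smul, Real.norm_of_nonneg hR.le, Real.mul_rpow hR.le (norm_nonneg _)]
  simp_rw [h2] at h
  rw [integral_const_mul] at h
  have hRd : R ^ d ≠ 0 := by positivity
  rw [sub_eq_add_neg, Real.rpow_add hR, Real.rpow_natCast, mul_assoc, h, mul_inv_cancel_left₀ hRd]

theorem integral_heatKernel_mul_norm_sub_rpow_neg_le {d : ℕ} (hd : 1 ≤ d) {α : ℝ} (hα0 : 0 < α)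
    (hα : α < d) {v : ℝ} (hv : 0 < v) (w : EuclideanSpace ℝ (Fin d)) :
    ∫ z, heatKernel d v z * (‖w - z‖ ^ (-α) + 1) ≤
      ((2 * Real.pi) ^ (-(d : ℝ) / 2) *
        (∫ y in Metric.ball (0 : EuclideanSpace ℝ (Fin d)) 1, ‖y‖ ^ (-α)) + 1) * v ^ (-(α / 2)) +
        1 := by
  set A : ℝ := (2 * Real.pi * v) ^ (-(d : ℝ) / 2)
  set φ : EuclideanSpace ℝ (Fin d) → ℝ :=
    (Metric.ball 0 (√v)).indicator (fun y => ‖y‖ ^ (-α)) with hφ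
  have hsv : 0 < √v := Real.sqrt_pos.2 hv
  have hφi : Integrable φ :=
    (integrable_indicator_iff measurableSet_ball).2 (integrableOn_ball_norm_rpow_neg hd hα _)
  have hsqrt : (√v) ^ (-α) = v ^ (-(α / 2)) := by
    rw [Real.sqrt_eq_rpow, ← Real.rpow_mul hv.le]
    congr 1
    ring
  have hint : Integrable fun z => A * φ (w - z) + heatKernel d v z * (v ^ (-(α / 2)) + 1) :=
    ((hφi.comp_sub_left w).const_mul A).add ((integrable_heatKernel_s14 d hv).mul_const _)
  refine (integral_mono_of_nonneg (Filter.Eventually.of_forall fun z => ?_) hint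
    (Filter.Eventually.of_forall fun z => ?_)).trans_eq ?_
  · exact mul_nonneg (heatKernel_nonneg d hv z) (by positivity)
  · have hA := heatKernel_le d hv z
    have h0 := heatKernel_nonneg d hv z
    have hvα : 0 < v ^ (-(α / 2)) := by positivity
    simp only [hφ, Set.indicator, Metric.mem_ball, dist_zero_right]
    split_ifs with h
    · have hn : 0 ≤ ‖w - z‖ ^ (-α) := by positivity
      nlinarith [mul_le_mul_of_nonneg_right hA hn, mul_nonneg h0 hvα.le]
    · have hn : ‖w - z‖ ^ (-α) ≤ v ^ (-(α / 2)) := by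
        rw [← hsqrt]
        exact Real.rpow_le_rpow_of_nonpos hsv (not_lt.1 h) (by linarith)
      nlinarith [mul_le_mul_of_nonneg_left hn h0]
  · rw [integral_add ((hφi.comp_sub_left w).const_mul A)
      ((integrable_heatKernel_s14 d hv).mul_const _), integral_const_mul, integral_mul_const,
      integral_heatKernel_s14 d hv, integral_sub_left_eq_self φ volume w, hφ,
      integral_indicator measurableSet_ball, setIntegral_ball_norm_rpow_neg d α hsv]
    have hA : A * (√v) ^ ((d : ℝ) - α) = (2 * Real.pi) ^ (-(d : ℝ) / 2) * v ^ (-(α / 2)) := by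
      simp only [A]
      rw [Real.mul_rpow (by positivity) hv.le, Real.sqrt_eq_rpow, ← Real.rpow_mul hv.le, mul_assoc,
        ← Real.rpow_add hv]
      congr 2
      ring
    rw [← mul_assoc, hA]
    ring

theorem exists_integral_heatKernel_mul_heatKernel_le {d : ℕ} (hd : 1 ≤ d) {α : ℝ} (hα0 : 0 < α)
    (hα : α < d) :
    ∃ K : ℝ, 0 ≤ K ∧ ∀ u v : ℝ, 0 < u → 0 < v →
      ∫ w : EuclideanSpace ℝ (Fin d), ∫ z : EuclideanSpace ℝ (Fin d),
        heatKernel d u w * heatKernel d v z * (‖w - z‖ ^ (-α) + 1) ≤ K * v ^ (-(α / 2)) + 1 := by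
  set K : ℝ := (2 * Real.pi) ^ (-(d : ℝ) / 2) *
    (∫ y in Metric.ball (0 : EuclideanSpace ℝ (Fin d)) 1, ‖y‖ ^ (-α)) + 1
  have hK : 0 ≤ K := add_nonneg
    (mul_nonneg (by positivity) (integral_nonneg fun y => by positivity)) zero_le_one
  refine ⟨K, hK, fun u v hu hv => ?_⟩
  simp_rw [mul_assoc, integral_const_mul]
  calc _ ≤ ∫ w, heatKernel d u w * (K * v ^ (-(α / 2)) + 1) := by
        refine integral_mono_of_nonneg (Filter.Eventually.of_forall fun w => ?_)
          ((integrable_heatKernel_s14 d hu).mul_const _) (Filter.Eventually.of_forall fun w => ?_)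
        · exact mul_nonneg (heatKernel_nonneg d hu w)
            (integral_nonneg fun z => mul_nonneg (heatKernel_nonneg d hv z) (by positivity))
        · exact mul_le_mul_of_nonneg_left
            (integral_heatKernel_mul_norm_sub_rpow_neg_le hd hα0 hα hv w)
            (heatKernel_nonneg d hu w)
    _ = _ := by rw [integral_mul_const, integral_heatKernel_s14 d hu, one_mul]

theorem lintegral_Ioo_ofReal_rpow_sub_left {p s t : ℝ} (hp : 0 < p) (hst : s ≤ t) :
    ∫⁻ r in Set.Ioo s t, ENNReal.ofReal ((t - r) ^ (p - 1)) =
      ENNReal.ofReal ((t - s) ^ p / p) := by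
  have hi : IntervalIntegrable (fun r : ℝ => (t - r) ^ (p - 1)) volume s t := by
    have h := (intervalIntegral.intervalIntegrable_rpow' (a := t - s) (b := 0)
      (r := p - 1) (by linarith)).comp_sub_left t
    simpa using h
  rw [← ofReal_integral_eq_lintegral_ofReal
    ((intervalIntegrable_iff_integrableOn_Ioo_of_le hst).1 hi)
    ((ae_restrict_iff' measurableSet_Ioo).2 (Filter.Eventually.of_forall fun r hr =>
      Real.rpow_nonneg (sub_nonneg.2 hr.2.le) _)),
    ← integral_Ioc_eq_integral_Ioo, ← intervalIntegral.integral_of_le hst,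
    intervalIntegral.integral_comp_sub_left (fun x : ℝ => x ^ (p - 1)) t,
    integral_rpow (Or.inl (by linarith))]
  simp [hp.ne']

theorem lintegral_Ioo_ofReal_rpow_sub_right {q s t : ℝ} (hq : 0 < q) (hst : s ≤ t) :
    ∫⁻ r in Set.Ioo s t, ENNReal.ofReal ((r - s) ^ (q - 1)) =
      ENNReal.ofReal ((t - s) ^ q / q) := by
  have hi : IntervalIntegrable (fun r : ℝ => (r - s) ^ (q - 1)) volume s t := by
    have h := (intervalIntegral.intervalIntegrable_rpow' (a := 0) (b := t - s)
      (r := q - 1) (by linarith)).comp_sub_right s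
    simpa using h
  rw [← ofReal_integral_eq_lintegral_ofReal
    ((intervalIntegrable_iff_integrableOn_Ioo_of_le hst).1 hi)
    ((ae_restrict_iff' measurableSet_Ioo).2 (Filter.Eventually.of_forall fun r hr =>
      Real.rpow_nonneg (sub_nonneg.2 hr.1.le) _)),
    ← integral_Ioc_eq_integral_Ioo, ← intervalIntegral.integral_of_le hst,
    intervalIntegral.integral_comp_sub_right (fun x : ℝ => x ^ (q - 1)) s,
    integral_rpow (Or.inl (by linarith))]
  simp [hq.ne']

/-- A scaled beta integral is bounded by a multiple of the corresponding power. -/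
theorem exists_lintegral_Ioo_ofReal_rpow_mul_rpow_le {p q : ℝ} (hp : 0 < p) (hp1 : p ≤ 1)
    (hq : 0 < q) (hq1 : q ≤ 1) :
    ∃ M : ℝ, 0 ≤ M ∧ ∀ s t : ℝ, s < t →
      ∫⁻ r in Set.Ioo s t, ENNReal.ofReal ((t - r) ^ (p - 1) * (r - s) ^ (q - 1)) ≤
        ENNReal.ofReal (M * (t - s) ^ (p + q - 1)) := by
  refine ⟨(1 / 2) ^ (q - 1) / p + (1 / 2) ^ (p - 1) / q, by positivity, fun s t hst => ?_⟩
  have hts : 0 < t - s := sub_pos.2 hst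
  have hpt : ∀ r ∈ Set.Ioo s t, (t - r) ^ (p - 1) * (r - s) ^ (q - 1) ≤
      (1 / 2 * (t - s)) ^ (q - 1) * (t - r) ^ (p - 1) +
        (1 / 2 * (t - s)) ^ (p - 1) * (r - s) ^ (q - 1) := by
    intro r hr
    have h1 : 0 < t - r := sub_pos.2 hr.2
    have h2 : 0 < r - s := sub_pos.2 hr.1
    have e1 : 0 < (t - r) ^ (p - 1) := by positivity
    have e2 : 0 < (r - s) ^ (q - 1) := by positivity
    have e3 : 0 < (1 / 2 * (t - s)) ^ (q - 1) := by positivity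
    have e4 : 0 < (1 / 2 * (t - s)) ^ (p - 1) := by positivity
    rcases le_total (1 / 2 * (t - s)) (r - s) with h | h
    · have := Real.rpow_le_rpow_of_nonpos (by positivity) h (show q - 1 ≤ 0 by linarith)
      nlinarith [mul_le_mul_of_nonneg_left this e1.le, mul_pos e4 e2]
    · have := Real.rpow_le_rpow_of_nonpos (by positivity)
        (show 1 / 2 * (t - s) ≤ t - r by linarith) (show p - 1 ≤ 0 by linarith)
      nlinarith [mul_le_mul_of_nonneg_right this e2.le, mul_pos e3 e1]
  calc _ ≤ ∫⁻ r in Set.Ioo s t,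
        (ENNReal.ofReal ((1 / 2 * (t - s)) ^ (q - 1)) * ENNReal.ofReal ((t - r) ^ (p - 1)) +
          ENNReal.ofReal ((1 / 2 * (t - s)) ^ (p - 1)) * ENNReal.ofReal ((r - s) ^ (q - 1))) := by
        refine setLIntegral_mono' measurableSet_Ioo fun r hr => ?_
        have h1 : 0 < t - r := sub_pos.2 hr.2
        have h2 : 0 < r - s := sub_pos.2 hr.1
        rw [← ENNReal.ofReal_mul (by positivity), ← ENNReal.ofReal_mul (by positivity),
          ← ENNReal.ofReal_add (by positivity) (by positivity)]
        exact ENNReal.ofReal_le_ofReal (hpt r hr)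
    _ = _ := by
        rw [lintegral_add_left (by fun_prop), lintegral_const_mul _ (by fun_prop),
          lintegral_const_mul _ (by fun_prop), lintegral_Ioo_ofReal_rpow_sub_left hp hst.le,
          lintegral_Ioo_ofReal_rpow_sub_right hq hst.le, ← ENNReal.ofReal_mul (by positivity),
          ← ENNReal.ofReal_mul (by positivity), ← ENNReal.ofReal_add (by positivity) (by positivity)]
        congr 1
        rw [Real.mul_rpow (by norm_num) hts.le, Real.mul_rpow (by norm_num) hts.le,
          show p + q - 1 = (q - 1) + p by ring, Real.rpow_add hts]
        have : (t - s) ^ (p - 1) * (t - s) ^ q = (t - s) ^ (q - 1) * (t - s) ^ p := by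
          rw [← Real.rpow_add hts, ← Real.rpow_add hts]
          congr 1
          ring
        linear_combination (1 / 2) ^ (p - 1) / q * this

open scoped ENNReal in
theorem lintegral_Ioo_min_le {f g : ℝ → ℝ → ℝ≥0∞} {h : ℝ → ℝ≥0∞} (hf : Measurable f.uncurry)
    (hg : Measurable g.uncurry) (hh : Measurable h) (t : ℝ) :
    ∫⁻ r in Set.Ioo 0 t, ∫⁻ r' in Set.Ioo 0 t, ∫⁻ s in Set.Ioo 0 (min r r'),
        h s * f s r * g s r' ≤
      ∫⁻ s in Set.Ioo 0 t,
        h s * (∫⁻ r in Set.Ioo s t, f s r) * ∫⁻ r' in Set.Ioo s t, g s r' := by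
  have hmeas : ∀ k : ℝ → ℝ → ℝ≥0∞, Measurable k.uncurry →
      Measurable (fun x : ℝ × ℝ => (Set.Ioi x.1).indicator (k x.1) x.2) := fun k hk =>
    Measurable.ite (p := fun x : ℝ × ℝ => x.2 ∈ Set.Ioi x.1)
      (measurableSet_lt measurable_fst measurable_snd) hk measurable_const
  have hf' := hmeas f hf
  have hg' := hmeas g hg
  have hG : Measurable fun s => ∫⁻ r' in Set.Ioo 0 t, (Set.Ioi s).indicator (g s) r' :=
    hg'.lintegral_prod_right'
  have hfs : ∀ s, Measurable fun r => (Set.Ioi s).indicator (f s) r := fun s =>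
    hf'.comp measurable_prodMk_left
  have hgs : ∀ s, Measurable fun r => (Set.Ioi s).indicator (g s) r := fun s =>
    hg'.comp measurable_prodMk_left
  have hset : ∀ (k : ℝ → ℝ≥0∞) (s : ℝ), ∫⁻ r in Set.Ioo 0 t, (Set.Ioi s).indicator k r ≤
      ∫⁻ r in Set.Ioo s t, k r := by
    intro k s
    rw [setLIntegral_indicator measurableSet_Ioi]
    exact lintegral_mono_set fun r hr => ⟨hr.1, hr.2.2⟩
  calc _ ≤ ∫⁻ r in Set.Ioo 0 t, ∫⁻ r' in Set.Ioo 0 t, ∫⁻ s in Set.Ioo 0 t,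
        h s * (Set.Ioi s).indicator (f s) r * (Set.Ioi s).indicator (g s) r' := by
        refine setLIntegral_mono' measurableSet_Ioo fun r hr =>
          setLIntegral_mono' measurableSet_Ioo fun r' hr' => ?_
        refine (setLIntegral_mono' measurableSet_Ioo fun s hs => ?_).trans
          (lintegral_mono_set (Set.Ioo_subset_Ioo_right ((min_le_left _ _).trans hr.2.le)))
        have h1 : s < r := hs.2.trans_le (min_le_left _ _)
        have h2 : s < r' := hs.2.trans_le (min_le_right _ _)
        simp [h1, h2]
    _ = ∫⁻ r in Set.Ioo 0 t, ∫⁻ s in Set.Ioo 0 t, h s * (Set.Ioi s).indicator (f s) r *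
          ∫⁻ r' in Set.Ioo 0 t, (Set.Ioi s).indicator (g s) r' := by
        refine lintegral_congr fun r => ?_
        rw [lintegral_lintegral_swap]
        · exact lintegral_congr fun s => lintegral_const_mul _ (hgs s)
        · exact (((hh.comp measurable_snd).mul
            (hf'.comp (measurable_snd.prodMk measurable_const))).mul
            (hg'.comp measurable_swap)).aemeasurable
    _ = ∫⁻ s in Set.Ioo 0 t, h s * (∫⁻ r in Set.Ioo 0 t, (Set.Ioi s).indicator (f s) r) *
          ∫⁻ r' in Set.Ioo 0 t, (Set.Ioi s).indicator (g s) r' := by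
        rw [lintegral_lintegral_swap]
        · refine lintegral_congr fun s => ?_
          rw [lintegral_mul_const _ ((hfs s).const_mul _), lintegral_const_mul _ (hfs s)]
        · exact (((hh.comp measurable_snd).mul (hf'.comp measurable_swap)).mul
            (hG.comp measurable_snd)).aemeasurable
    _ ≤ _ := by
        exact lintegral_mono fun s => mul_le_mul' (mul_le_mul' le_rfl (hset _ _)) (hset _ _)

theorem exists_lintegral_Ioo_min_rpow_le {p q q' β K : ℝ} (hp : 0 < p) (hp1 : p ≤ 1)
    (hq : 0 < q) (hq1 : q ≤ 1) (hq' : 0 < q') (hq'1 : q' ≤ 1)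
    (hβ : 0 < β + 2 * p + q + q' - 1) (hβ' : 0 < β + 2 * p + 2 * q - 1) (hK : 0 ≤ K) :
    ∃ M : ℝ, 0 ≤ M ∧ ∀ t : ℝ, 0 < t →
      ∫⁻ r in Set.Ioo 0 t, ∫⁻ r' in Set.Ioo 0 t, ∫⁻ s in Set.Ioo 0 (min r r'),
        ENNReal.ofReal ((t - s) ^ β) *
          ENNReal.ofReal ((t - r) ^ (p - 1) * (r - s) ^ (q - 1)) *
          (ENNReal.ofReal K * ENNReal.ofReal ((t - r') ^ (p - 1) * (r' - s) ^ (q' - 1)) +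
            ENNReal.ofReal ((t - r') ^ (p - 1) * (r' - s) ^ (q - 1))) ≤
        ENNReal.ofReal (M * (t ^ (β + 2 * p + q + q' - 1) + t ^ (β + 2 * p + 2 * q - 1))) := by
  obtain ⟨M, hM, hMb⟩ := exists_lintegral_Ioo_ofReal_rpow_mul_rpow_le hp hp1 hq hq1
  obtain ⟨M', hM', hMb'⟩ := exists_lintegral_Ioo_ofReal_rpow_mul_rpow_le hp hp1 hq' hq'1
  set θ := β + 2 * p + q + q' - 1 with hθ
  set η := β + 2 * p + 2 * q - 1 with hη
  refine ⟨M * K * M' / θ + M * M / η, by positivity, fun t ht => ?_⟩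
  refine (lintegral_Ioo_min_le
    (f := fun s r => ENNReal.ofReal ((t - r) ^ (p - 1) * (r - s) ^ (q - 1)))
    (g := fun s r' =>
      ENNReal.ofReal K * ENNReal.ofReal ((t - r') ^ (p - 1) * (r' - s) ^ (q' - 1)) +
        ENNReal.ofReal ((t - r') ^ (p - 1) * (r' - s) ^ (q - 1)))
    (h := fun s => ENNReal.ofReal ((t - s) ^ β))
    (by unfold Function.uncurry; fun_prop) (by unfold Function.uncurry; fun_prop)
    (by fun_prop) t).trans ?_
  calc _ ≤ ∫⁻ s in Set.Ioo 0 t,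
        (ENNReal.ofReal (M * K * M') * ENNReal.ofReal ((t - s) ^ (θ - 1)) +
          ENNReal.ofReal (M * M) * ENNReal.ofReal ((t - s) ^ (η - 1))) := by
        refine setLIntegral_mono' measurableSet_Ioo fun s hs => ?_
        have hts : 0 < t - s := sub_pos.2 hs.2
        rw [lintegral_add_left (by fun_prop), lintegral_const_mul _ (by fun_prop)]
        refine (mul_le_mul' (mul_le_mul' le_rfl (hMb s t hs.2))
          (add_le_add (mul_le_mul' le_rfl (hMb' s t hs.2)) (hMb s t hs.2))).trans_eq ?_
        rw [← ENNReal.ofReal_mul (by positivity), ← ENNReal.ofReal_mul (by positivity),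
          ← ENNReal.ofReal_mul (by positivity), ← ENNReal.ofReal_mul (by positivity),
          ← ENNReal.ofReal_add (by positivity) (by positivity),
          ← ENNReal.ofReal_add (by positivity) (by positivity),
          ← ENNReal.ofReal_mul (by positivity)]
        congr 1
        rw [show θ - 1 = β + (p + q - 1) + (p + q' - 1) by rw [hθ]; ring,
          show η - 1 = β + (p + q - 1) + (p + q - 1) by rw [hη]; ring, Real.rpow_add hts,
          Real.rpow_add hts, Real.rpow_add hts, Real.rpow_add hts]
        ring
    _ = ENNReal.ofReal (M * K * M' * (t ^ θ / θ) + M * M * (t ^ η / η)) := by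
        rw [lintegral_add_left (by fun_prop), lintegral_const_mul _ (by fun_prop),
          lintegral_const_mul _ (by fun_prop), lintegral_Ioo_ofReal_rpow_sub_left hβ ht.le,
          lintegral_Ioo_ofReal_rpow_sub_left hβ' ht.le,
          ← ENNReal.ofReal_mul (by positivity), ← ENNReal.ofReal_mul (by positivity),
          sub_zero, ← ENNReal.ofReal_add (by positivity) (by positivity)]
    _ ≤ _ := by
        refine ENNReal.ofReal_le_ofReal ?_
        have h1 : 0 ≤ M * K * M' / θ * t ^ η := by positivity
        have h2 : 0 ≤ M * M / η * t ^ θ := by positivity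
        calc _ = M * K * M' / θ * t ^ θ + M * M / η * t ^ η := by ring
          _ ≤ _ := by linarith

theorem ofReal_integral_le_lintegral_ofReal {X : Type*} [MeasurableSpace X] {μ : Measure X}
    (f : X → ℝ) : ENNReal.ofReal (∫ x, f x ∂μ) ≤ ∫⁻ x, ENNReal.ofReal (f x) ∂μ := by
  by_cases hf : Integrable f μ
  · rw [integral_eq_lintegral_pos_part_sub_lintegral_neg_part hf]
    exact (ENNReal.ofReal_le_ofReal (sub_le_self _ ENNReal.toReal_nonneg)).trans
      ENNReal.ofReal_toReal_le
  · simp [integral_undef hf]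

theorem ofReal_intervalIntegral_le_lintegral_Ioo (f : ℝ → ℝ) {s t : ℝ} (hst : s ≤ t) :
    ENNReal.ofReal (∫ x in s..t, f x) ≤ ∫⁻ x in Set.Ioo s t, ENNReal.ofReal (f x) := by
  rw [intervalIntegral.integral_of_le hst, integral_Ioc_eq_integral_Ioo]
  exact ofReal_integral_le_lintegral_ofReal f

/-- Let `0 < α < min(d,2)`, `b, c ≥ 0` with `c < (b+1−α/2)/2` and
`a ∈ (c, 1−α/2)`. Then there is a finite constant `C` such that for every `t ≥ 0`,
`Q(t) = ∫_0^t ∫_0^t (t−r)^{a−1−c}(t−r')^{a−1−c} ∫_0^{min(r,r')} (t−s)^b (r−s)^{-a}(r'−s)^{-a}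
  [∫∫ p_{r−s}(w) p_{r'−s}(z) (|w−z|^{-α}+1) dw dz] ds dr dr'
  ≤ C (t^{b+1−α/2−2c} + t^{b+1−2c})`. -/
theorem heatKernel_Q_integral_bound
    (d : ℕ) (hd : 1 ≤ d) (α : ℝ) (hα0 : 0 < α) (hαd : α < min (d : ℝ) 2)
    (b c : ℝ) (hb : 0 ≤ b) (hc : 0 ≤ c) (hcb : c < (b + 1 - α / 2) / 2)
    (a : ℝ) (hca : c < a) (ha : a < 1 - α / 2) :
    ∃ C : ℝ, 0 < C ∧ ∀ t : ℝ, 0 ≤ t →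
      (∫ r in (0 : ℝ)..t, ∫ r' in (0 : ℝ)..t,
          (t - r) ^ (a - 1 - c) * (t - r') ^ (a - 1 - c) *
            ∫ s in (0 : ℝ)..(min r r'),
              (t - s) ^ b * (r - s) ^ (-a) * (r' - s) ^ (-a) *
                ∫ w : EuclideanSpace ℝ (Fin d), ∫ z : EuclideanSpace ℝ (Fin d),
                  heatKernel d (r - s) w * heatKernel d (r' - s) z * (‖w - z‖ ^ (-α) + 1))
        ≤ C * (t ^ (b + 1 - α / 2 - 2 * c) + t ^ (b + 1 - 2 * c)) := by
  have hα : α < d := hαd.trans_le (min_le_left _ _)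
  obtain ⟨K, hK, hJ⟩ := exists_integral_heatKernel_mul_heatKernel_le hd hα0 hα
  obtain ⟨M, hM, hb_bound⟩ := exists_lintegral_Ioo_min_rpow_le (p := a - c) (q := 1 - a)
    (q' := 1 - a - α / 2) (β := b) (K := K) (by linarith) (by linarith) (by linarith)
    (by linarith) (by linarith) (by linarith) (by linarith) (by linarith) hK
  refine ⟨M + 1, by positivity, fun t ht => ?_⟩
  rcases ht.eq_or_lt with rfl | ht
  · rw [intervalIntegral.integral_same]
    positivity
  refine le_trans ?_ (mul_le_mul_of_nonneg_right (le_add_of_nonneg_right zero_le_one)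
    (by positivity))
  rw [← ENNReal.ofReal_le_ofReal_iff (by positivity)]
  have hbt := hb_bound t ht
  rw [show b + 2 * (a - c) + (1 - a) + (1 - a - α / 2) - 1 = b + 1 - α / 2 - 2 * c by ring,
    show b + 2 * (a - c) + 2 * (1 - a) - 1 = b + 1 - 2 * c by ring,
    show a - c - 1 = a - 1 - c by ring, show 1 - a - 1 = -a by ring,
    show 1 - a - α / 2 - 1 = -a + -(α / 2) by ring] at hbt
  refine le_trans ?_ hbt
  refine (ofReal_intervalIntegral_le_lintegral_Ioo _ ht.le).trans
    (setLIntegral_mono' measurableSet_Ioo fun r hr => ?_)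
  refine (ofReal_intervalIntegral_le_lintegral_Ioo _ ht.le).trans
    (setLIntegral_mono' measurableSet_Ioo fun r' hr' => ?_)
  rw [← intervalIntegral.integral_const_mul]
  refine (ofReal_intervalIntegral_le_lintegral_Ioo _ (le_min hr.1.le hr'.1.le)).trans
    (setLIntegral_mono' measurableSet_Ioo fun s hs => ?_)
  have hsr : 0 < r - s := sub_pos.2 (hs.2.trans_le (min_le_left _ _))
  have hsr' : 0 < r' - s := sub_pos.2 (hs.2.trans_le (min_le_right _ _))
  have htr : 0 < t - r := sub_pos.2 hr.2
  have htr' : 0 < t - r' := sub_pos.2 hr'.2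
  have hts : 0 < t - s := by linarith
  rw [← ENNReal.ofReal_mul (by positivity), ← ENNReal.ofReal_mul (by positivity),
    ← ENNReal.ofReal_add (by positivity) (by positivity), ← ENNReal.ofReal_mul (by positivity)]
  refine ENNReal.ofReal_le_ofReal ?_
  rw [Real.rpow_add hsr']
  calc _ ≤ (t - r) ^ (a - 1 - c) * (t - r') ^ (a - 1 - c) *
        ((t - s) ^ b * (r - s) ^ (-a) * (r' - s) ^ (-a) * (K * (r' - s) ^ (-(α / 2)) + 1)) := by
        refine mul_le_mul_of_nonneg_left (mul_le_mul_of_nonneg_left ?_ (by positivity))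
          (by positivity)
        exact hJ _ _ hsr hsr'
    _ = _ := by ring
end
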